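/- arXiv:2507.06187 — 3 statements merged into one kernel-verified Lean document; each statement's English description precedes it below -/
import Mathlib

section
/- Let d ≥ 1, let a, b ∈ ℝ^d, and let θ* ∈ ℝ^d be a unit vector. Then for every t ∈ ℝ such that a + t·b ≠ 0, the second derivative of f(s) = ⟨a + s·b, θ*⟩ / ‖a + s·b‖ at s = t satisfies |f″(t)| ≤ (2/√3) · ‖b‖² / ‖a + t·b‖². -/
open RealInnerProductSpace

lemma aux_r {d : ℕ} (a b : EuclideanSpace ℝ (Fin d)) (t : ℝ) (h : a + t • b ≠ 0) :
    HasDerivAt (fun s : ℝ => ‖a + s • b‖) (⟪a + t • b, b⟫ / ‖a + t • b‖) t := by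
  have hv : HasDerivAt (fun s : ℝ => a + s • b) b t := by
    simpa using ((hasDerivAt_id t).smul_const b).const_add a
  have h1 := (hv.norm_sq).sqrt (by positivity)
  have h2 : (fun s : ℝ => √(‖a + s • b‖ ^ 2)) = fun s => ‖a + s • b‖ := by
    funext s; exact Real.sqrt_sq (norm_nonneg _)
  rw [h2, Real.sqrt_sq (norm_nonneg _)] at h1
  refine h1.congr_deriv ?_
  have : ‖a + t • b‖ ≠ 0 := by simpa using h
  field_simp

lemma aux_p {d : ℕ} (a b c : EuclideanSpace ℝ (Fin d)) (t : ℝ) :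
    HasDerivAt (fun s : ℝ => ⟪a + s • b, c⟫) ⟪b, c⟫ t := by
  have hv : HasDerivAt (fun s : ℝ => a + s • b) b t := by
    simpa using ((hasDerivAt_id t).smul_const b).const_add a
  simpa using hv.inner ℝ (hasDerivAt_const t c)

lemma aux_d1 {d : ℕ} (a b θ : EuclideanSpace ℝ (Fin d)) (t : ℝ) (h : a + t • b ≠ 0) :
    HasDerivAt (fun s : ℝ => ⟪a + s • b, θ⟫ / ‖a + s • b‖)
      (⟪b, θ⟫ / ‖a + t • b‖ - ⟪a + t • b, θ⟫ * ⟪a + t • b, b⟫ / ‖a + t • b‖ ^ 3) t := by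
  have hr : ‖a + t • b‖ ≠ 0 := by simpa using h
  refine ((aux_p a b θ t).fun_div (aux_r a b t h) hr).congr_deriv ?_
  field_simp

lemma aux_d2 {d : ℕ} (a b θ : EuclideanSpace ℝ (Fin d)) (t : ℝ) (h : a + t • b ≠ 0) :
    HasDerivAt (fun t : ℝ => 
      ⟪b, θ⟫ / ‖a + t • b‖ - ⟪a + t • b, θ⟫ * ⟪a + t • b, b⟫ / ‖a + t • b‖ ^ 3)
      (-2 * ⟪b, θ⟫ * ⟪a + t • b, b⟫ / ‖a + t • b‖ ^ 3
        + ⟪a + t • b, θ⟫ * (3 * ⟪a + t • b, b⟫ ^ 2 / ‖a + t • b‖ ^ 5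
          - ‖b‖ ^ 2 / ‖a + t • b‖ ^ 3)) t := by
  have hr : ‖a + t • b‖ ≠ 0 := by simpa using h
  have h1 := (hasDerivAt_const t ⟪b, θ⟫).fun_div (aux_r a b t h) hr
  have h2 := ((aux_p a b θ t).fun_mul (aux_p a b b t)).fun_div ((aux_r a b t h).fun_pow 3)
    (pow_ne_zero 3 hr)
  refine (h1.fun_sub h2).congr_deriv ?_
  rw [real_inner_self_eq_norm_sq]
  generalize ⟪a + t • b, b⟫ = c
  generalize ⟪a + t • b, θ⟫ = p
  generalize ‖a + t • b‖ = r at *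
  field_simp
  push_cast
  ring

/-- For `a, b ∈ ℝ^d`, a unit vector `θ*`, and every `t ∈ ℝ` with
`a + t·b ≠ 0`, the second derivative of `f(s) = ⟨a + s·b, θ*⟩ / ‖a + s·b‖` at `s = t`
satisfies `|f″(t)| ≤ (2/√3) · ‖b‖² / ‖a + t·b‖²`. -/
theorem stmt_5 (d : ℕ) (hd : 1 ≤ d) (a b θs : EuclideanSpace ℝ (Fin d))
    (hθs : ‖θs‖ = 1) (t : ℝ) (h : a + t • b ≠ 0) :
    |deriv (deriv (fun s : ℝ => ⟪a + s • b, θs⟫ / ‖a + s • b‖)) t|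
      ≤ (2 / Real.sqrt 3) * ‖b‖ ^ 2 / ‖a + t • b‖ ^ 2 := by
  have hev : ∀ᶠ s in nhds t, a + s • b ≠ 0 := by
    have hc : Continuous (fun s : ℝ => a + s • b) := by fun_prop
    exact hc.continuousAt.eventually_ne h
  have hd1 : deriv (fun s : ℝ => ⟪a + s • b, θs⟫ / ‖a + s • b‖) =ᶠ[nhds t] (fun t : ℝ => 
      ⟪b, θs⟫ / ‖a + t • b‖ - ⟪a + t • b, θs⟫ * ⟪a + t • b, b⟫ / ‖a + t • b‖ ^ 3) := by
    filter_upwards [hev] with s hs using (aux_d1 a b θs s hs).deriv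
  rw [hd1.deriv_eq, (aux_d2 a b θs t h).deriv]
  generalize a + t • b = v at *
  have hr : 0 < ‖v‖ := by simpa using h
  set x : ℝ := -2 * ⟪v, b⟫ / ‖v‖ ^ 3 with hx
  set y : ℝ := 3 * ⟪v, b⟫ ^ 2 / ‖v‖ ^ 5 - ‖b‖ ^ 2 / ‖v‖ ^ 3 with hy
  have e : -2 * ⟪b, θs⟫ * ⟪v, b⟫ / ‖v‖ ^ 3 + ⟪v, θs⟫ * y = ⟪x • b + y • v, θs⟫ := by
    rw [inner_add_left, real_inner_smul_left, real_inner_smul_left, hx]; ring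
  rw [e]
  have h1 := abs_real_inner_le_norm (x • b + y • v) θs
  rw [hθs, mul_one] at h1
  refine h1.trans (abs_le_of_sq_le_sq' ?_ (by positivity)).2
  have h3 : (√3 : ℝ) ^ 2 = 3 := Real.sq_sqrt (by norm_num)
  have h4 : (2 / √3 * ‖b‖ ^ 2 / ‖v‖ ^ 2) ^ 2 = 2 ^ 2 / 3 * (‖b‖ ^ 2) ^ 2 / (‖v‖ ^ 2) ^ 2 := by
    rw [div_pow, mul_pow, div_pow, h3]
  rw [h4, norm_add_sq_real, real_inner_smul_left, real_inner_smul_right, norm_smul, norm_smul,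
    mul_pow, mul_pow, Real.norm_eq_abs, Real.norm_eq_abs, sq_abs, sq_abs, real_inner_comm,
    hx, hy]
  generalize ⟪v, b⟫ = c
  generalize ‖v‖ = r at *
  generalize ‖b‖ = B
  rw [← sub_nonneg]
  have : (2 ^ 2 / 3 * (B ^ 2) ^ 2 / (r ^ 2) ^ 2 - ((-2 * c / r ^ 3) ^ 2 * B ^ 2 + 2 * (-2 * c / r ^ 3 * ((3 * c ^ 2 / r ^ 5 - B ^ 2 / r ^ 3) * c)) + (3 * c ^ 2 / r ^ 5 - B ^ 2 / r ^ 3) ^ 2 * r ^ 2)) = (3 * c ^ 2 - B ^ 2 * r ^ 2) ^ 2 / (3 * r ^ 8) := by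
    field_simp
    ring
  rw [this]
  positivity
end

section
/- Let d ≥ 1, let a, b ∈ ℝ^d with b ≠ 0, and let t ∈ ℝ be such that a + t·b ≠ 0. Define u(s) = (a + s·b)/‖a + s·b‖ in a neighborhood of t, and set c = ⟨a + t·b, b⟩ / (‖a + t·b‖ · ‖b‖). Then the second derivative of u at t satisfies ‖u″(t)‖² = (‖b‖⁴ / ‖a + t·b‖⁴) · (−3c⁴ + 2c² + 1). -/
open RealInnerProductSpace

theorem aux_inv {d : ℕ} (a b : EuclideanSpace ℝ (Fin d)) (s : ℝ) (h : a + s • b ≠ 0) :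
    HasDerivAt (fun s : ℝ => ‖a + s • b‖⁻¹) (-(inner ℝ (a + s • b) b) * (‖a + s • b‖⁻¹) ^ 3) s := by
  have hr : ‖a + s • b‖ ≠ 0 := norm_ne_zero_iff.mpr h
  have hv : HasDerivAt (fun s : ℝ => a + s • b) b s := by
    simpa using ((hasDerivAt_id s).smul_const b).const_add a
  have h2 := hv.norm_sq
  have h3 := (h2.sqrt (by positivity)).inv (by rw [Real.sqrt_sq (norm_nonneg _)]; exact hr)
  have h4 : (fun s : ℝ => ‖a + s • b‖⁻¹) = (fun s : ℝ => √(‖a + s • b‖ ^ 2))⁻¹ := by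
    funext x
    simp [Real.sqrt_sq (norm_nonneg _)]
  rw [h4]
  refine h3.congr_deriv ?_
  simp only [Real.sqrt_sq (norm_nonneg _)]
  field_simp

theorem aux_line {d : ℕ} (a b : EuclideanSpace ℝ (Fin d)) (s : ℝ) :
    HasDerivAt (fun s : ℝ => a + s • b) b s := by
  simpa using ((hasDerivAt_id s).smul_const b).const_add a

theorem aux_first {d : ℕ} (a b : EuclideanSpace ℝ (Fin d)) (s : ℝ) (h : a + s • b ≠ 0) :
    HasDerivAt (fun s : ℝ => ‖a + s • b‖⁻¹ • (a + s • b))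
      (‖a + s • b‖⁻¹ • b + (-(inner ℝ (a + s • b) b) * (‖a + s • b‖⁻¹) ^ 3) • (a + s • b)) s :=
  (aux_inv a b s h).smul (aux_line a b s)

theorem aux_second {d : ℕ} (a b : EuclideanSpace ℝ (Fin d)) (t : ℝ) (h : a + t • b ≠ 0) :
    deriv (deriv (fun s : ℝ => ‖a + s • b‖⁻¹ • (a + s • b))) t =
      (-2 * inner ℝ (a + t • b) b * (‖a + t • b‖⁻¹) ^ 3) • b +
      (3 * (inner ℝ (a + t • b) b) ^ 2 * (‖a + t • b‖⁻¹) ^ 5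
        - ‖b‖ ^ 2 * (‖a + t • b‖⁻¹) ^ 3) • (a + t • b) := by
  have hev : ∀ᶠ s in nhds t, a + s • b ≠ 0 :=
    (aux_line a b t).continuousAt.eventually_ne h
  have he : deriv (fun s : ℝ => ‖a + s • b‖⁻¹ • (a + s • b)) =ᶠ[nhds t] fun s =>
      ‖a + s • b‖⁻¹ • b + (-(inner ℝ (a + s • b) b) * (‖a + s • b‖⁻¹) ^ 3) • (a + s • b) := by
    filter_upwards [hev] with s hs using (aux_first a b s hs).deriv
  rw [he.deriv_eq]
  have hi := aux_inv a b t h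
  have hl := aux_line a b t
  have hp : HasDerivAt (fun s : ℝ => -(inner ℝ (a + s • b) b)) (-(‖b‖ ^ 2)) t := by
    have := (hl.inner ℝ (hasDerivAt_const t b)).neg
    refine this.congr_deriv ?_
    simp
  have h1 := (hi.smul_const b).add ((hp.mul (hi.pow 3)).smul hl)
  refine (h1.congr_deriv ?_).deriv
  simp only [Pi.mul_apply, Pi.pow_apply]
  module

/-- For `a, b ∈ ℝ^d` with `b ≠ 0` and `t ∈ ℝ` with `a + t·b ≠ 0`, the
second derivative at `t` of `u(s) = (a + s·b)/‖a + s·b‖` satisfies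
`‖u″(t)‖² = (‖b‖⁴ / ‖a + t·b‖⁴) · (−3c⁴ + 2c² + 1)`, where
`c = ⟨a + t·b, b⟩ / (‖a + t·b‖ · ‖b‖)`. -/
theorem stmt_6 (d : ℕ) (hd : 1 ≤ d) (a b : EuclideanSpace ℝ (Fin d))
    (hb : b ≠ 0) (t : ℝ) (h : a + t • b ≠ 0)
    (c : ℝ) (hc : c = ⟪a + t • b, b⟫ / (‖a + t • b‖ * ‖b‖)) :
    ‖deriv (deriv (fun s : ℝ => ‖a + s • b‖⁻¹ • (a + s • b))) t‖ ^ 2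
      = (‖b‖ ^ 4 / ‖a + t • b‖ ^ 4) * (-3 * c ^ 4 + 2 * c ^ 2 + 1) := by
  rw [aux_second a b t h]
  have hr : ‖a + t • b‖ ≠ 0 := norm_ne_zero_iff.mpr h
  have hb' : ‖b‖ ≠ 0 := norm_ne_zero_iff.mpr hb
  have hp : ⟪a + t • b, b⟫ = c * (‖a + t • b‖ * ‖b‖) := by
    rw [hc]; field_simp
  rw [norm_add_sq_real, norm_smul, norm_smul, inner_smul_left, inner_smul_right,
    real_inner_comm (a + t • b) b, mul_pow, mul_pow, Real.norm_eq_abs, Real.norm_eq_abs, sq_abs, sq_abs, hp]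
  simp only [conj_trivial]
  field_simp
  ring
end

section
/- Let d ≥ 1, let θ* ∈ ℝ^d be a unit vector, let θ_0 ∈ ℝ^d be nonzero, let Γ ∈ (0, 1], and let θ̄, θ ∈ ℝ^d. If (i) ⟨θ̄, θ*⟩/‖θ̄‖ − ⟨θ_0, θ*⟩/‖θ_0‖ ≥ Γ, (ii) ‖θ̄‖ ≥ ‖θ_0‖/2, and (iii) ‖θ − θ̄‖ ≤ Γ‖θ_0‖/8, then ⟨θ, θ*⟩/‖θ‖ ≥ ⟨θ_0, θ*⟩/‖θ_0‖ + Γ/2. -/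
open RealInnerProductSpace

/-- Let `θ*` be a unit vector, `θ_0 ≠ 0`, `Γ ∈ (0,1]`, and `θ̄, θ ∈ ℝ^d`.
If `⟨θ̄, θ*⟩/‖θ̄‖ − ⟨θ_0, θ*⟩/‖θ_0‖ ≥ Γ`, `‖θ̄‖ ≥ ‖θ_0‖/2`, and `‖θ − θ̄‖ ≤ Γ‖θ_0‖/8`,
then `⟨θ, θ*⟩/‖θ‖ ≥ ⟨θ_0, θ*⟩/‖θ_0‖ + Γ/2`. -/
theorem stmt_14 (d : ℕ) (hd : 1 ≤ d) (θs θ0 θbar θ : EuclideanSpace ℝ (Fin d))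
    (hθs : ‖θs‖ = 1) (hθ0 : θ0 ≠ 0) (Γ : ℝ) (hΓ0 : 0 < Γ) (hΓ1 : Γ ≤ 1)
    (h1 : Γ ≤ ⟪θbar, θs⟫ / ‖θbar‖ - ⟪θ0, θs⟫ / ‖θ0‖)
    (h2 : ‖θ0‖ / 2 ≤ ‖θbar‖)
    (h3 : ‖θ - θbar‖ ≤ Γ * ‖θ0‖ / 8) :
    ⟪θ0, θs⟫ / ‖θ0‖ + Γ / 2 ≤ ⟪θ, θs⟫ / ‖θ‖ := by
  have hn0 : 0 < ‖θ0‖ := norm_pos_iff.mpr hθ0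
  have hb : 0 < ‖θbar‖ := by linarith
  have he : ‖θ - θbar‖ ≤ Γ * ‖θbar‖ / 4 := by nlinarith
  have hab : |‖θ‖ - ‖θbar‖| ≤ ‖θ - θbar‖ := abs_norm_sub_norm_le θ θbar
  have ha : 0 < ‖θ‖ := by
    have := (abs_le.mp hab).1
    nlinarith
  have hp : |⟪θ - θbar, θs⟫| ≤ ‖θ - θbar‖ := by
    simpa [hθs] using abs_real_inner_le_norm (θ - θbar) θs
  rw [inner_sub_left] at hp
  have hP : |⟪θ, θs⟫ / ‖θ‖| ≤ 1 := by
    rw [abs_div, abs_norm, div_le_one ha]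
    simpa [hθs] using abs_real_inner_le_norm θ θs
  have hpe : ⟪θ, θs⟫ = ⟪θ, θs⟫ / ‖θ‖ * ‖θ‖ := by field_simp
  have hqe : ⟪θbar, θs⟫ = ⟪θbar, θs⟫ / ‖θbar‖ * ‖θbar‖ := by field_simp
  generalize ⟪θ, θs⟫ / ‖θ‖ = P at *
  generalize ⟪θbar, θs⟫ / ‖θbar‖ = Q at *
  have hx : |P * (‖θ‖ - ‖θbar‖)| ≤ ‖θ - θbar‖ := by
    rw [abs_mul]
    nlinarith [abs_nonneg P, abs_nonneg (‖θ‖ - ‖θbar‖)]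
  have hx' := (abs_le.mp hx).2
  have hp' := (abs_le.mp hp).1
  have key : (Q - Γ / 2) * ‖θbar‖ ≤ P * ‖θbar‖ := by linarith
  have := le_of_mul_le_mul_right key hb
  linarith
end
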